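/- Waist-type inequality for central sections of symmetric convex spherical bodies: let K₀ ⊆ ℝ^n be a bounded symmetric convex set with nonempty interior, K = q(K₀), and let u ∈ ℝ^{n+1} be a unit vector with ⟨u, o⟩ = 0. Then μ_{n-1}(K ∩ u^⊥) / μ_n(K) ≥ μ_{n-1}(S^n ∩ u^⊥ ∩ S^n_+) / μ_n(S^n_+), i.e., the central great-hypersphere section of K, relative to the volume of K, is at least as large as the corresponding ratio for the hemisphere B(o, π/2). -/

import Mathlib

open MeasureTheory Real
open scoped RealInnerProductSpace ENNReal

/-- Density (up to constant) of the Cauchy measure on `ℝⁿ`. -/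
noncomputable def cauchyDensity (n : ℕ) (x : EuclideanSpace ℝ (Fin n)) : ℝ :=
  (1 + ‖x‖ ^ 2) ^ (-(((n : ℝ) + 1) / 2))

/-- Normalizing constant of the Cauchy measure. -/
noncomputable def cauchyConst (n : ℕ) : ℝ :=
  (∫ x : EuclideanSpace ℝ (Fin n), cauchyDensity n x)⁻¹

/-- The Cauchy measure `ν_n` on `ℝⁿ`. -/
noncomputable def cauchyMeasure (n : ℕ) : Measure (EuclideanSpace ℝ (Fin n)) :=
  volume.withDensity fun x => ENNReal.ofReal (cauchyConst n * cauchyDensity n x)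

/-- Gnomonic projection of `ℝⁿ` onto the open upper hemisphere of `Sⁿ ⊆ ℝ^{n+1}`. -/
noncomputable def gnomonic (n : ℕ) (x : EuclideanSpace ℝ (Fin n)) :
    EuclideanSpace ℝ (Fin (n + 1)) :=
  (Real.sqrt (1 + ‖x‖ ^ 2))⁻¹ •
    ((EuclideanSpace.equiv (Fin (n + 1)) ℝ).symm (Fin.snoc (fun i => x i) 1))

/-- The pole `o = e_{n+1}`. -/
noncomputable def pole (n : ℕ) : EuclideanSpace ℝ (Fin (n + 1)) :=
  EuclideanSpace.single (Fin.last n) 1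

/-- The unit sphere `Sⁿ ⊆ ℝ^{n+1}` as a set. -/
noncomputable def unitSphereSet (n : ℕ) : Set (EuclideanSpace ℝ (Fin (n + 1))) :=
  Metric.sphere 0 1

/-- The open hemisphere `Sⁿ₊` centered at the pole. -/
noncomputable def hemisphere (n : ℕ) : Set (EuclideanSpace ℝ (Fin (n + 1))) :=
  {y ∈ unitSphereSet n | 0 < ⟪y, pole n⟫}

open ProbabilityTheory Filter Topology Set

theorem volume_add_volume_le_of_isCompact {A B C : Set ℝ} (hA : IsCompact A) (hB : IsCompact B)
    (hA' : A.Nonempty) (hB' : B.Nonempty)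
    (h : ∀ x ∈ A, ∀ y ∈ B, midpoint ℝ x y ∈ C) :
    volume A + volume B ≤ 2 * volume C := by
  obtain ⟨a, haA, ha⟩ := hA.exists_isGreatest hA'
  obtain ⟨b, hbB, hb⟩ := hB.exists_isLeast hB'
  have hC : volume ((fun x : ℝ => 2⁻¹ * x) ⁻¹' C) = 2 * volume C := by
    rw [Real.volume_preimage_mul_left (by norm_num)]
    simp
  have e : ∀ x y : ℝ, midpoint ℝ x y = 2⁻¹ * (x + y) := fun x y => by
    simp [midpoint_eq_smul_add]
  rw [← hC]
  have h1 : volume ((fun x => x + -b) ⁻¹' A) = volume A := measure_preimage_add_right _ _ _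
  have h2 : volume ((fun x => x + -a) ⁻¹' B) = volume B := measure_preimage_add_right _ _ _
  rw [← h1, ← h2, ← measure_union₀]
  · apply measure_mono
    rintro x (hx | hx)
    · have := h _ hx _ hbB
      rw [e] at this
      simpa using this
    · have := h _ haA _ hx
      rw [e] at this
      simpa using this
  · exact ((measurable_id.add_const _) hB.measurableSet).nullMeasurableSet
  · refine measure_mono_null (t := {a + b}) ?_ (by simp)
    rintro x ⟨hx, hx'⟩
    have h3 := ha hx
    have h4 := hb hx'
    simp only [mem_singleton_iff]
    linarith

theorem volume_add_volume_le {A B C : Set ℝ} (hA : MeasurableSet A) (hB : MeasurableSet B)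
    (hA' : A.Nonempty) (hB' : B.Nonempty)
    (h : ∀ x ∈ A, ∀ y ∈ B, midpoint ℝ x y ∈ C) :
    volume A + volume B ≤ 2 * volume C := by
  obtain ⟨a, ha⟩ := hA'
  obtain ⟨b, hb⟩ := hB'
  rw [hA.measure_eq_iSup_isCompact volume, hB.measure_eq_iSup_isCompact volume]
  simp only [iSup_and']
  refine ENNReal.biSup_add_biSup_le' ⟨∅, by simp⟩ ⟨∅, by simp⟩ fun K hK L hL => ?_
  refine le_trans ?_ (volume_add_volume_le_of_isCompact (hK.2.insert a) (hL.2.insert b)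
    (insert_nonempty _ _) (insert_nonempty _ _) (fun x hx y hy =>
      h x (insert_subset ha hK.1 hx) y (insert_subset hb hL.1 hy)))
  exact add_le_add (measure_mono (subset_insert _ _)) (measure_mono (subset_insert _ _))

theorem lintegral_eq_lintegral_Ioo_meas_lt {f : ℝ → ℝ≥0∞} (hf : Measurable f) (hf1 : ∀ x, f x ≤ 1) :
    ∫⁻ x, f x = ∫⁻ t in Ioo (0 : ℝ) 1, volume {x | ENNReal.ofReal t < f x} := by
  have h := lintegral_eq_lintegral_meas_lt volume (f := fun x => (f x).toReal)
    (ae_of_all _ fun x => ENNReal.toReal_nonneg) hf.ennreal_toReal.aemeasurable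
  have hfin : ∀ x, f x ≠ ∞ := fun x => ((hf1 x).trans_lt ENNReal.one_lt_top).ne
  simp only [ENNReal.ofReal_toReal (hfin _)] at h
  rw [h, ← Ioo_union_Ici_eq_Ioi (zero_lt_one' ℝ),
    lintegral_union measurableSet_Ici (by
      rw [Set.disjoint_left]; intro x hx hx'; exact absurd hx.2 (not_lt.2 hx'))]
  have h0 : ∫⁻ t in Ici (1 : ℝ), volume {a | t < (f a).toReal} = 0 := by
    rw [setLIntegral_congr_fun (g := 0) measurableSet_Ici]
    · simp
    · intro t ht
      have : {a | t < (f a).toReal} = ∅ := by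
        ext a
        simp only [mem_ofPred_eq, mem_empty_iff_false, iff_false, not_lt]
        exact (ENNReal.toReal_le_of_le_ofReal zero_le_one (by simpa using hf1 a)).trans ht
      simp [this]
  rw [h0, add_zero]
  refine setLIntegral_congr_fun measurableSet_Ioo fun t ht => ?_
  simp only [ENNReal.ofReal_lt_iff_lt_toReal ht.1.le (hfin _)]

theorem lintegral_add_lintegral_le_of_normalized {f g h : ℝ → ℝ≥0∞}
    (hf : Measurable f) (hg : Measurable g) (hh : Measurable h)
    (hf1 : ⨆ x, f x = 1) (hg1 : ⨆ x, g x = 1)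
    (H : ∀ x y, f x * g y ≤ h (midpoint ℝ x y) ^ 2) :
    (∫⁻ x, f x) + ∫⁻ x, g x ≤ 2 * ∫⁻ x, h x := by
  have hk : Measurable fun x => min (h x) 1 := hh.min measurable_const
  calc (∫⁻ x, f x) + ∫⁻ x, g x
      = ∫⁻ t in Ioo (0 : ℝ) 1, (volume {x | ENNReal.ofReal t < f x} +
          volume {x | ENNReal.ofReal t < g x}) := by
        rw [lintegral_eq_lintegral_Ioo_meas_lt hf (fun x => hf1 ▸ le_iSup f x),
          lintegral_eq_lintegral_Ioo_meas_lt hg (fun x => hg1 ▸ le_iSup g x),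
          lintegral_add_left]
        exact Antitone.measurable fun s t hst => measure_mono fun x hx =>
          (ENNReal.ofReal_le_ofReal hst).trans_lt hx
    _ ≤ ∫⁻ t in Ioo (0 : ℝ) 1, 2 * volume {x | ENNReal.ofReal t < min (h x) 1} := by
        refine setLIntegral_mono' measurableSet_Ioo fun t ht => ?_
        have ht1 : ENNReal.ofReal t < 1 := by simpa using ht.2
        refine volume_add_volume_le (measurableSet_lt measurable_const hf)
          (measurableSet_lt measurable_const hg) (lt_iSup_iff.1 (ht1.trans_eq hf1.symm) :)
          (lt_iSup_iff.1 (ht1.trans_eq hg1.symm) :) fun x hx y hy => lt_min ?_ ht1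
        have h2 : ENNReal.ofReal t ^ 2 < h (midpoint ℝ x y) ^ 2 := by
          rw [sq]
          exact (ENNReal.mul_lt_mul hx hy).trans_le (H x y)
        exact lt_of_not_ge fun h' => absurd h2 (not_lt.2 (pow_le_pow_left' h' 2))
    _ = 2 * ∫⁻ x, min (h x) 1 := by
        rw [lintegral_const_mul' _ _ (by simp),
          lintegral_eq_lintegral_Ioo_meas_lt hk (fun x => min_le_right _ _)]
    _ ≤ 2 * ∫⁻ x, h x := by
        gcongr
        exact min_le_left _ _

theorem ENNReal.four_mul_mul_le_add_sq (x y : ℝ≥0∞) : 4 * (x * y) ≤ (x + y) ^ 2 := by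
  wlog h : x ≤ y generalizing x y
  · simpa only [mul_comm, add_comm] using this y x (le_of_not_ge h)
  obtain ⟨d, rfl⟩ := exists_add_of_le h
  calc 4 * (x * (x + d)) ≤ 4 * (x * (x + d)) + d ^ 2 := le_self_add
    _ = (x + (x + d)) ^ 2 := by ring

theorem lintegral_mul_lintegral_le_sq_real {f g h : ℝ → ℝ≥0∞}
    (hf : Measurable f) (hg : Measurable g) (hh : Measurable h) {M : ℝ≥0∞} (hM : M ≠ ∞)
    (hfM : ∀ x, f x ≤ M) (hgM : ∀ x, g x ≤ M)
    (H : ∀ x y, f x * g y ≤ h (midpoint ℝ x y) ^ 2) :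
    (∫⁻ x, f x) * ∫⁻ x, g x ≤ (∫⁻ x, h x) ^ 2 := by
  set a := ⨆ x, f x with ha
  set b := ⨆ x, g x with hb
  have haM : a ≠ ∞ := ((iSup_le hfM).trans_lt hM.lt_top).ne
  have hbM : b ≠ ∞ := ((iSup_le hgM).trans_lt hM.lt_top).ne
  rcases eq_or_ne a 0 with h0 | ha0
  · have : ∀ x, f x = 0 := by simpa [ha] using h0
    simp [this]
  rcases eq_or_ne b 0 with h0 | hb0
  · have : ∀ x, g x = 0 := by simpa [hb] using h0
    simp [this]
  set c : ℝ≥0∞ := (a * b) ^ (2⁻¹ : ℝ) with hc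
  have hc2 : c ^ 2 = a * b := by
    rw [hc, ← ENNReal.rpow_natCast, ← ENNReal.rpow_mul]
    simp
  have key := lintegral_add_lintegral_le_of_normalized (f := fun x => a⁻¹ * f x)
    (g := fun x => b⁻¹ * g x) (h := fun x => c⁻¹ * h x) (hf.const_mul _) (hg.const_mul _)
    (hh.const_mul _)
    (by rw [← ENNReal.mul_iSup, ← ha, ENNReal.inv_mul_cancel ha0 haM])
    (by rw [← ENNReal.mul_iSup, ← hb, ENNReal.inv_mul_cancel hb0 hbM])
    (fun x y => by
      rw [mul_pow, ← ENNReal.inv_pow, hc2, ENNReal.mul_inv (.inl ha0) (.inl haM)]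
      calc a⁻¹ * f x * (b⁻¹ * g y) = a⁻¹ * b⁻¹ * (f x * g y) := by ring
        _ ≤ _ := by gcongr; exact H x y)
  rw [lintegral_const_mul _ hf, lintegral_const_mul _ hg, lintegral_const_mul _ hh] at key
  set F := ∫⁻ x, f x
  set G := ∫⁻ x, g x
  set I := ∫⁻ x, h x
  have h4 : 4 * (F * G) ≤ 4 * I ^ 2 := by
    calc 4 * (F * G) = (a * a⁻¹) * (b * b⁻¹) * (4 * (F * G)) := by
          rw [ENNReal.mul_inv_cancel ha0 haM, ENNReal.mul_inv_cancel hb0 hbM]; simp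
      _ = a * b * (4 * ((a⁻¹ * F) * (b⁻¹ * G))) := by ring
      _ ≤ a * b * (a⁻¹ * F + b⁻¹ * G) ^ 2 := by
          gcongr; exact ENNReal.four_mul_mul_le_add_sq _ _
      _ ≤ c ^ 2 * (2 * (c⁻¹ * I)) ^ 2 := by rw [hc2]; gcongr
      _ = (c ^ 2 * (c ^ 2)⁻¹) * (4 * I ^ 2) := by rw [ENNReal.inv_pow]; ring
      _ = 4 * I ^ 2 := by
          rw [ENNReal.mul_inv_cancel, one_mul]
          · rw [hc2]; exact mul_ne_zero ha0 hb0
          · rw [hc2]; exact ENNReal.mul_ne_top haM hbM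
  exact (ENNReal.mul_le_mul_iff_right (by norm_num) (by norm_num)).1 h4

/-- The midpoint case of the Prékopa–Leindler inequality for functions bounded by `1`. -/
def SatisfiesPrekopaLeindler {E : Type*} [AddCommGroup E] [Module ℝ E] [MeasurableSpace E]
    (μ : Measure E) : Prop :=
  ∀ f g h : E → ℝ≥0∞, Measurable f → Measurable g → Measurable h →
    (∀ x, f x ≤ 1) → (∀ x, g x ≤ 1) → (∀ x y, f x * g y ≤ h (midpoint ℝ x y) ^ 2) →
    (∫⁻ x, f x ∂μ) * ∫⁻ x, g x ∂μ ≤ (∫⁻ x, h x ∂μ) ^ 2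

theorem gaussianPDFReal_mul_le (x y : ℝ) :
    gaussianPDFReal 0 1 x * gaussianPDFReal 0 1 y ≤ gaussianPDFReal 0 1 (midpoint ℝ x y) ^ 2 := by
  simp only [gaussianPDFReal, midpoint_eq_smul_add, NNReal.coe_one, mul_one, sub_zero, mul_pow,
    ← Real.exp_nat_mul]
  rw [mul_mul_mul_comm, ← Real.exp_add, ← sq]
  gcongr
  simp only [smul_eq_mul, Nat.cast_ofNat, invOf_eq_inv]
  nlinarith [sq_nonneg (x - y)]

theorem gaussianPDFReal_le_one (x : ℝ) : gaussianPDFReal 0 1 x ≤ 1 := by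
  simp only [gaussianPDFReal, NNReal.coe_one, mul_one, sub_zero]
  refine mul_le_one₀ (inv_le_one_of_one_le₀ ?_) (Real.exp_nonneg _) ?_
  · rw [Real.one_le_sqrt]; nlinarith [Real.pi_gt_three]
  · rw [Real.exp_le_one_iff]; nlinarith [sq_nonneg x]

theorem satisfiesPrekopaLeindler_gaussianReal : SatisfiesPrekopaLeindler (gaussianReal 0 1) := by
  intro f g h hf hg hh hf1 hg1 H
  have hp := measurable_gaussianPDF 0 1
  have hp1 : ∀ x, gaussianPDF 0 1 x ≤ 1 := fun x => by
    simpa [gaussianPDF] using gaussianPDFReal_le_one x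
  rw [gaussianReal_of_var_ne_zero 0 one_ne_zero, lintegral_withDensity_eq_lintegral_mul _ hp hf,
    lintegral_withDensity_eq_lintegral_mul _ hp hg, lintegral_withDensity_eq_lintegral_mul _ hp hh]
  refine lintegral_mul_lintegral_le_sq_real (hp.mul hf) (hp.mul hg) (hp.mul hh) ENNReal.one_ne_top
    (fun x => mul_le_one' (hp1 x) (hf1 x)) (fun x => mul_le_one' (hp1 x) (hg1 x)) fun x y => ?_
  simp only [Pi.mul_apply]
  rw [mul_mul_mul_comm, mul_pow]
  refine mul_le_mul' ?_ (H x y)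
  simp only [gaussianPDF]
  rw [← ENNReal.ofReal_mul (gaussianPDFReal_nonneg _ _ _),
    ← ENNReal.ofReal_pow (gaussianPDFReal_nonneg _ _ _)]
  exact ENNReal.ofReal_le_ofReal (gaussianPDFReal_mul_le x y)

theorem SatisfiesPrekopaLeindler.prod {E F : Type*} [AddCommGroup E] [Module ℝ E]
    [MeasurableSpace E] [AddCommGroup F] [Module ℝ F] [MeasurableSpace F]
    {μ : Measure E} {ν : Measure F} [SFinite μ] [IsProbabilityMeasure ν]
    (hμ : SatisfiesPrekopaLeindler μ) (hν : SatisfiesPrekopaLeindler ν) :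
    SatisfiesPrekopaLeindler (μ.prod ν) := by
  intro f g h hf hg hh hf1 hg1 H
  rw [lintegral_prod _ hf.aemeasurable, lintegral_prod _ hg.aemeasurable,
    lintegral_prod _ hh.aemeasurable]
  have le_one : ∀ k : E × F → ℝ≥0∞, (∀ z, k z ≤ 1) → ∀ x, ∫⁻ y, k (x, y) ∂ν ≤ 1 :=
    fun k hk x => (lintegral_mono fun y => hk (x, y)).trans (by simp)
  refine hμ _ _ _ hf.lintegral_prod_right' hg.lintegral_prod_right' hh.lintegral_prod_right'
    (le_one f hf1) (le_one g hg1) fun x y => ?_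
  refine hν _ _ _ (hf.comp measurable_prodMk_left) (hg.comp measurable_prodMk_left)
    (hh.comp measurable_prodMk_left) (fun _ => hf1 _) (fun _ => hg1 _) fun z w => ?_
  simpa [midpoint_eq_smul_add] using H (x, z) (y, w)

theorem SatisfiesPrekopaLeindler.map {E F : Type*} [AddCommGroup E] [Module ℝ E]
    [MeasurableSpace E] [AddCommGroup F] [Module ℝ F] [MeasurableSpace F]
    {μ : Measure E} (hμ : SatisfiesPrekopaLeindler μ) (L : E →ₗ[ℝ] F) (hL : Measurable L) :
    SatisfiesPrekopaLeindler (μ.map L) := by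
  intro f g h hf hg hh hf1 hg1 H
  rw [lintegral_map hf hL, lintegral_map hg hL, lintegral_map hh hL]
  refine hμ _ _ _ (hf.comp hL) (hg.comp hL) (hh.comp hL) (fun _ => hf1 _) (fun _ => hg1 _)
    fun x y => ?_
  simpa [midpoint_eq_smul_add] using H (L x) (L y)

section Gaussian

variable {V : Type*} [NormedAddCommGroup V] [InnerProductSpace ℝ V]

/-- The linear map `(s, z) ↦ s • u + z` assembling `V` from the line through `u`
and its orthogonal complement. -/
noncomputable def lineSum (u : V) : ℝ × (ℝ ∙ u)ᗮ →ₗ[ℝ] V :=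
  (LinearMap.toSpanSingleton ℝ V u).coprod (ℝ ∙ u)ᗮ.subtype

theorem lineSum_apply (u : V) (p : ℝ × (ℝ ∙ u)ᗮ) : lineSum u p = p.1 • u + (p.2 : V) := rfl

theorem inner_coe_orthogonal_eq (u t : V) (z : (ℝ ∙ u)ᗮ) :
    ⟪(z : V), t⟫ = ⟪z, (ℝ ∙ u)ᗮ.orthogonalProjectionOnto t⟫ := by
  rw [Submodule.inner_orthogonalProjectionOnto_eq_of_mem_left]

theorem norm_sq_eq_inner_sq_add {u : V} (hu : ‖u‖ = 1) (t : V) :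
    ‖t‖ ^ 2 = ⟪u, t⟫ ^ 2 + ‖(ℝ ∙ u)ᗮ.orthogonalProjectionOnto t‖ ^ 2 := by
  rw [Submodule.norm_sq_eq_add_norm_sq_projection t (ℝ ∙ u)]
  congr 1
  rw [← Submodule.norm_coe, Submodule.coe_orthogonalProjectionOnto_apply,
    Submodule.starProjection_unit_singleton ℝ hu, norm_smul, hu, mul_one, Real.norm_eq_abs, sq_abs]

variable [FiniteDimensional ℝ V] [MeasurableSpace V] [BorelSpace V]

theorem measurable_lineSum (u : V) : Measurable (lineSum u) :=
  (lineSum u).continuous_of_finiteDimensional.measurable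

/-- The standard Gaussian measure is the product of its marginals on a line and on the orthogonal
complement of that line. -/
theorem map_lineSum_prod {u : V} (hu : ‖u‖ = 1) :
    ((gaussianReal 0 1).prod (stdGaussian (ℝ ∙ u)ᗮ)).map (lineSum u) = stdGaussian V := by
  have := Measure.isProbabilityMeasure_map (μ := (gaussianReal 0 1).prod (stdGaussian (ℝ ∙ u)ᗮ))
    (measurable_lineSum u).aemeasurable
  refine Measure.ext_of_charFun ?_
  ext t
  rw [charFun_stdGaussian, charFun_apply, integral_map (measurable_lineSum u).aemeasurable
    (Measurable.aestronglyMeasurable (by fun_prop))]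
  have key : ∀ p : ℝ × (ℝ ∙ u)ᗮ, Complex.exp ((⟪lineSum u p, t⟫ : ℝ) * Complex.I) =
      Complex.exp ((⟪p.1, ⟪u, t⟫⟫ : ℝ) * Complex.I) *
      Complex.exp ((⟪p.2, (ℝ ∙ u)ᗮ.orthogonalProjectionOnto t⟫ : ℝ) * Complex.I) := fun p => by
    rw [← Complex.exp_add, lineSum_apply, inner_add_left, inner_smul_left,
      inner_coe_orthogonal_eq]
    congr 1
    simp [mul_comm]
    ring
  simp_rw [key]
  rw [integral_prod_mul (fun s : ℝ => Complex.exp ((⟪s, ⟪u, t⟫⟫ : ℝ) * Complex.I))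
    (fun z : (ℝ ∙ u)ᗮ =>
      Complex.exp ((⟪z, (ℝ ∙ u)ᗮ.orthogonalProjectionOnto t⟫ : ℝ) * Complex.I)),
    ← charFun_apply, ← charFun_apply, charFun_stdGaussian, charFun_gaussianReal,
    ← Complex.exp_add]
  congr 1
  have := norm_sq_eq_inner_sq_add hu t
  rw [← Complex.ofReal_pow ‖t‖, this]
  push_cast
  simp
  ring

theorem stdGaussian_apply_eq_lintegral {u : V} (hu : ‖u‖ = 1) {C : Set V} (hC : MeasurableSet C) :
    stdGaussian V C =
      ∫⁻ s, stdGaussian (ℝ ∙ u)ᗮ {z | s • u + (z : V) ∈ C} ∂(gaussianReal 0 1) := by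
  rw [← map_lineSum_prod hu, Measure.map_apply (measurable_lineSum u) hC,
    Measure.prod_apply (measurable_lineSum u hC)]
  rfl

theorem satisfiesPrekopaLeindler_stdGaussian (V : Type*) [NormedAddCommGroup V]
    [InnerProductSpace ℝ V] [FiniteDimensional ℝ V] [MeasurableSpace V] [BorelSpace V] :
    SatisfiesPrekopaLeindler (stdGaussian V) := by
  induction h : Module.finrank ℝ V generalizing V with
  | zero =>
    have : Subsingleton V := Module.finrank_zero_iff.1 h
    intro f g k hf hg hk hf1 hg1 H
    have e : ∀ k : V → ℝ≥0∞, ∫⁻ x, k x ∂(stdGaussian V) = k 0 := fun k => by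
      rw [lintegral_congr (g := fun _ => k 0) fun x => by rw [Subsingleton.elim x 0]]
      simp
    simpa only [e, midpoint_self] using H 0 0
  | succ d ih =>
    have : Nontrivial V := Module.nontrivial_of_finrank_pos (R := ℝ) (by omega)
    obtain ⟨u, hu⟩ := exists_norm_eq V zero_le_one
    have : Fact (Module.finrank ℝ V = d + 1) := ⟨h⟩
    have hd : Module.finrank ℝ (ℝ ∙ u)ᗮ = d :=
      Submodule.finrank_orthogonal_span_singleton (norm_ne_zero_iff.1 (by simp [hu]))
    rw [← map_lineSum_prod hu]
    exact (satisfiesPrekopaLeindler_gaussianReal.prod (ih _ hd)).map _ (measurable_lineSum u)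

theorem stdGaussian_mul_le_sq {A B C : Set V} (hA : MeasurableSet A) (hB : MeasurableSet B)
    (hC : MeasurableSet C) (h : ∀ x ∈ A, ∀ y ∈ B, midpoint ℝ x y ∈ C) :
    stdGaussian V A * stdGaussian V B ≤ stdGaussian V C ^ 2 := by
  have := satisfiesPrekopaLeindler_stdGaussian V (A.indicator 1) (B.indicator 1) (C.indicator 1)
    (measurable_one.indicator hA) (measurable_one.indicator hB) (measurable_one.indicator hC)
    (fun x => indicator_le_self' (by simp) x) (fun x => indicator_le_self' (by simp) x)
    fun x y => by
      by_cases hx : x ∈ A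
      · by_cases hy : y ∈ B
        · simp [hx, hy, h x hx y hy]
        · simp [hy]
      · simp [hx]
  simpa only [lintegral_indicator_one hA, lintegral_indicator_one hB, lintegral_indicator_one hC]
    using this

/-- If a convex set is invariant under an isometry that reverses `u`, its central section orthogonal
to `u` has at least its own Gaussian measure. -/
theorem stdGaussian_le_stdGaussian_section {u : V} (hu : ‖u‖ = 1) {C : Set V} (hC : Convex ℝ C)
    (hCm : MeasurableSet C) (ρ : (ℝ ∙ u)ᗮ ≃ₗᵢ[ℝ] (ℝ ∙ u)ᗮ)
    (hρ : ∀ (s : ℝ) (z : (ℝ ∙ u)ᗮ), s • u + (z : V) ∈ C → (-s) • u + (ρ z : V) ∈ C) :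
    stdGaussian V C ≤ stdGaussian (ℝ ∙ u)ᗮ {z | (z : V) ∈ C} := by
  rw [stdGaussian_apply_eq_lintegral hu hCm]
  have hm : ∀ s : ℝ, MeasurableSet {z : (ℝ ∙ u)ᗮ | s • u + (z : V) ∈ C} := fun s =>
    (measurable_subtype_coe.const_add (s • u)) hCm
  have hle : ∀ s : ℝ, stdGaussian (ℝ ∙ u)ᗮ {z | s • u + (z : V) ∈ C} ≤
      stdGaussian (ℝ ∙ u)ᗮ {z | (z : V) ∈ C} := fun s => by
    have h1 : stdGaussian (ℝ ∙ u)ᗮ {z | s • u + (z : V) ∈ C} ≤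
        stdGaussian (ℝ ∙ u)ᗮ {z | (-s) • u + (z : V) ∈ C} := by
      conv_rhs => rw [← stdGaussian_map ρ,
        Measure.map_apply ρ.continuous.measurable (hm (-s))]
      exact measure_mono fun z hz => hρ s z hz
    have h2 := stdGaussian_mul_le_sq (hm s) (hm (-s)) (measurable_subtype_coe hCm)
      fun x hx y hy => by
        have := hC.midpoint_mem hx hy
        have e : midpoint ℝ (s • u + (x : V)) ((-s) • u + (y : V)) =
            ((midpoint ℝ x y : (ℝ ∙ u)ᗮ) : V) := by
          simp only [midpoint_eq_smul_add, Submodule.coe_smul, Submodule.coe_add]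
          congr 1
          module
        rwa [e] at this
    refine le_of_not_gt fun hlt => absurd ((mul_le_mul_right h1 _).trans h2) (not_le.2 ?_)
    rw [sq]
    exact ENNReal.mul_lt_mul hlt hlt
  calc _ ≤ ∫⁻ _, stdGaussian (ℝ ∙ u)ᗮ {z | (z : V) ∈ C} ∂(gaussianReal 0 1) :=
        lintegral_mono hle
    _ = _ := by simp

theorem stdGaussian_eq_stdGaussian_section {u : V} (hu : ‖u‖ = 1) {C : Set V}
    (hC : MeasurableSet C) (h : ∀ (s : ℝ) (z : V), s • u + z ∈ C ↔ z ∈ C) :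
    stdGaussian V C = stdGaussian (ℝ ∙ u)ᗮ {z | (z : V) ∈ C} := by
  rw [stdGaussian_apply_eq_lintegral hu hC]
  simp [h]

instance isOpenPosMeasure_stdGaussian : (stdGaussian V).IsOpenPosMeasure := by
  have : (gaussianReal 0 1).IsOpenPosMeasure :=
    (gaussianReal_absolutelyContinuous' 0 one_ne_zero).isOpenPosMeasure
  rw [stdGaussian_eq_map_pi_orthonormalBasis (stdOrthonormalBasis ℝ V)]
  refine Continuous.isOpenPosMeasure_map (by fun_prop) fun x => ?_
  exact ⟨(stdOrthonormalBasis ℝ V).repr x, by simp [OrthonormalBasis.sum_repr]⟩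

end Gaussian

section UniformlyDistributed

variable {X : Type*} [PseudoMetricSpace X] [MeasurableSpace X] [BorelSpace X]
  [SecondCountableTopology X] {μ ν : Measure X} [IsFiniteMeasure μ] [IsFiniteMeasure ν] {S : Set X}

theorem lintegral_measure_inter_ball {U : Set X} (hU : IsOpen U) (r : ℝ) :
    ∫⁻ x, ν (U ∩ Metric.ball x r) ∂μ = ∫⁻ y in U, μ (Metric.ball y r) ∂ν := by
  have hm : MeasurableSet {p : X × X | p.2 ∈ U ∧ dist p.1 p.2 < r} :=
    ((hU.preimage continuous_snd).inter (isOpen_lt continuous_dist continuous_const)).measurableSet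
  have h1 := Measure.prod_apply (μ := μ) (ν := ν) hm
  rw [Measure.prod_apply_symm hm] at h1
  have e1 : ∀ x, Prod.mk x ⁻¹' {p : X × X | p.2 ∈ U ∧ dist p.1 p.2 < r} = U ∩ Metric.ball x r :=
    fun x => by ext y; simp [dist_comm]
  have e2 : ∀ y, μ ((fun x => (x, y)) ⁻¹' {p : X × X | p.2 ∈ U ∧ dist p.1 p.2 < r}) =
      U.indicator (fun y => μ (Metric.ball y r)) y := fun y => by
    by_cases hy : y ∈ U
    · simp [hy, Metric.ball]
    · simp [hy]
  simp only [e1, e2] at h1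
  rw [← h1, lintegral_indicator hU.measurableSet]

theorem measure_le_mul_of_tendsto_ball_ratio {g h : ℕ → ℝ≥0∞} {r : ℕ → ℝ}
    (hr : Tendsto r atTop (𝓝 0)) (hμS : μ Sᶜ = 0) (hνS : ν Sᶜ = 0)
    (hg : ∀ k, ∀ x ∈ S, μ (Metric.ball x (r k)) = g k)
    (hh : ∀ k, ∀ x ∈ S, ν (Metric.ball x (r k)) = h k)
    (h0 : ∀ k, h k ≠ 0) (htop : ∀ k, h k ≠ ∞) {c : ℝ≥0∞}
    (hc : Tendsto (fun k => g k / h k) atTop (𝓝 c))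
    {U : Set X} (hU : IsOpen U) : μ U ≤ c * ν U := by
  have hquot : ∀ k, ∫⁻ x, ν (U ∩ Metric.ball x (r k)) / h k ∂μ = g k / h k * ν U := fun k => by
    simp only [div_eq_mul_inv]
    rw [lintegral_mul_const' _ _ (by simpa using h0 k), lintegral_measure_inter_ball hU,
      lintegral_congr_ae (g := fun _ => g k)]
    · simp [mul_right_comm]
    · refine ae_restrict_of_ae ?_
      filter_upwards [compl_mem_ae_iff.2 hνS] with y hy
      exact hg k y (by simpa using hy)
  have hlim : Tendsto (fun k => g k / h k * ν U) atTop (𝓝 (c * ν U)) :=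
    ENNReal.Tendsto.mul_const hc (.inr (measure_ne_top _ _))
  calc μ U = ∫⁻ x, U.indicator 1 x ∂μ := (lintegral_indicator_one hU.measurableSet).symm
    _ ≤ ∫⁻ x, liminf (fun k => ν (U ∩ Metric.ball x (r k)) / h k) atTop ∂μ := by
      refine lintegral_mono_ae ?_
      filter_upwards [compl_mem_ae_iff.2 hμS] with x hx
      by_cases hxU : x ∈ U
      · obtain ⟨ε, hε, hεU⟩ := Metric.isOpen_iff.1 hU x hxU
        refine (Tendsto.liminf_eq ?_).ge
        refine tendsto_const_nhds.congr' ?_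
        filter_upwards [hr.eventually (gt_mem_nhds hε)] with k hk
        rw [inter_eq_right.2 ((Metric.ball_subset_ball hk.le).trans hεU),
          hh k x (by simpa using hx), ENNReal.div_self (h0 k) (htop k)]
        simp [hxU]
      · simp [hxU]
    _ ≤ liminf (fun k => ∫⁻ x, ν (U ∩ Metric.ball x (r k)) / h k ∂μ) atTop := by
      refine lintegral_liminf_le fun k => Measurable.div_const ?_ _
      have hm : MeasurableSet {p : X × X | p.2 ∈ U ∧ dist p.1 p.2 < r k} :=
        ((hU.preimage continuous_snd).inter
          (isOpen_lt continuous_dist continuous_const)).measurableSet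
      convert measurable_measure_prodMk_left (ν := ν) hm using 2 with x
      congr 1
      ext y
      simp [dist_comm]
    _ = c * ν U := by simp_rw [hquot]; exact hlim.liminf_eq

/-- Two finite measures concentrated on a set on which each gives the same mass to all balls of a
given radius are proportional. -/
theorem exists_eq_smul_of_measure_ball_eq (hμS : μ Sᶜ = 0) (hνS : ν Sᶜ = 0) (hν : ν ≠ 0)
    (hμb : ∀ r, ∀ x ∈ S, ∀ y ∈ S, μ (Metric.ball x r) = μ (Metric.ball y r))
    (hνb : ∀ r, ∀ x ∈ S, ∀ y ∈ S, ν (Metric.ball x r) = ν (Metric.ball y r)) :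
    ∃ c : ℝ≥0∞, μ = c • ν := by
  rcases eq_or_ne μ 0 with rfl | hμ
  · exact ⟨0, by simp⟩
  have hS : S.Nonempty := by
    by_contra! h
    simp [h] at hνS
    exact hν hνS
  obtain ⟨x₀, hx₀⟩ := hS
  have pos : ∀ (m : Measure X), m Sᶜ = 0 → m ≠ 0 →
      (∀ r, ∀ x ∈ S, ∀ y ∈ S, m (Metric.ball x r) = m (Metric.ball y r)) →
      ∀ r > 0, m (Metric.ball x₀ r) ≠ 0 := fun m hmS hm hmb r hr h0 => hm <| by
    have : m S = 0 := measure_null_of_locally_null S fun x hx =>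
      ⟨Metric.ball x r, mem_nhdsWithin_of_mem_nhds (Metric.ball_mem_nhds x hr),
        (hmb r x hx x₀ hx₀).trans h0⟩
    rw [← Measure.measure_univ_eq_zero, ← union_compl_self S]
    exact measure_union_null this hmS
  set r : ℕ → ℝ := fun k => 1 / ((k : ℝ) + 1) with hr
  have hr0 : ∀ k, 0 < r k := fun k => Nat.one_div_pos_of_nat
  obtain ⟨c, φ, hφ, hc⟩ := CompactSpace.tendsto_subseq fun k =>
    μ (Metric.ball x₀ (r k)) / ν (Metric.ball x₀ (r k))
  have hrφ : Tendsto (r ∘ φ) atTop (𝓝 0) :=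
    tendsto_one_div_add_atTop_nhds_zero_nat.comp hφ.tendsto_atTop
  have hμ0 := fun k => pos μ hμS hμ hμb _ (hr0 (φ k))
  have hν0 := fun k => pos ν hνS hν hνb _ (hr0 (φ k))
  have hμν : ∀ U, IsOpen U → μ U ≤ c * ν U := fun U hU =>
    measure_le_mul_of_tendsto_ball_ratio hrφ hμS hνS (fun k x hx => hμb _ x hx x₀ hx₀)
      (fun k x hx => hνb _ x hx x₀ hx₀) hν0 (fun k => measure_ne_top _ _) hc hU
  have hνμ : ∀ U, IsOpen U → ν U ≤ c⁻¹ * μ U := fun U hU =>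
    measure_le_mul_of_tendsto_ball_ratio hrφ hνS hμS (fun k x hx => hνb _ x hx x₀ hx₀)
      (fun k x hx => hμb _ x hx x₀ hx₀) hμ0 (fun k => measure_ne_top _ _)
      ((hc.inv).congr fun k => ENNReal.inv_div (.inl (measure_ne_top _ _)) (.inl (hν0 k))) hU
  have hc0 : c ≠ 0 := by
    rintro rfl
    exact hμ (by simpa using hμν univ isOpen_univ)
  have hctop : c ≠ ∞ := by
    rintro rfl
    exact hν (by simpa using hνμ univ isOpen_univ)
  have heq : ∀ U, IsOpen U → μ U = (c • ν) U := fun U hU => by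
    refine le_antisymm (by simpa using hμν U hU) ?_
    calc (c • ν) U ≤ c * (c⁻¹ * μ U) := by
          simpa using mul_le_mul_right (hνμ U hU) c
      _ = μ U := by rw [← mul_assoc, ENNReal.mul_inv_cancel hc0 hctop, one_mul]
  refine ⟨c, ext_of_generate_finite {U : Set X | IsOpen U} (BorelSpace.measurable_eq (α := X))
    isPiSystem_isOpen (fun U hU => heq U hU) (heq univ isOpen_univ)⟩

end UniformlyDistributed

section Sphere

variable {V : Type*} [NormedAddCommGroup V] [InnerProductSpace ℝ V]

theorem norm_normalize_sub_normalize_le {x y : V} (hx : 1 ≤ ‖x‖) (hy : 1 ≤ ‖y‖) :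
    ‖‖x‖⁻¹ • x - ‖y‖⁻¹ • y‖ ≤ ‖x - y‖ := by
  have hx0 : 0 < ‖x‖ := by linarith
  have hy0 : 0 < ‖y‖ := by linarith
  refine le_of_sq_le_sq ?_ (norm_nonneg _)
  rw [norm_sub_sq_real, norm_sub_sq_real, norm_smul, norm_smul, inner_smul_left, inner_smul_right]
  have hi := real_inner_le_norm x y
  simp only [norm_inv, norm_norm, inv_mul_cancel₀ hx0.ne', inv_mul_cancel₀ hy0.ne', conj_trivial]
  obtain ⟨t, ht⟩ : ∃ t, ⟪x, y⟫ = ‖x‖ * ‖y‖ * t := ⟨⟪x, y⟫ / (‖x‖ * ‖y‖), by field_simp⟩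
  have ht1 : t ≤ 1 := by
    rw [ht] at hi
    exact le_of_mul_le_mul_left (by linarith) (mul_pos hx0 hy0)
  have e : ‖x‖⁻¹ * (‖y‖⁻¹ * ⟪x, y⟫) = t := by rw [ht]; field_simp
  rw [e, ht]
  have h1 : 1 ≤ ‖x‖ * ‖y‖ := by nlinarith
  nlinarith [sq_nonneg (‖x‖ - ‖y‖), mul_nonneg (sub_nonneg.2 h1) (sub_nonneg.2 ht1)]

theorem normalize_map (e : V ≃ₗᵢ[ℝ] V) (x : V) : ‖e x‖⁻¹ • e x = e (‖x‖⁻¹ • x) := by simp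

theorem exists_linearIsometryEquiv_map_eq {x y : V} (h : ‖x‖ = ‖y‖) :
    ∃ e : V ≃ₗᵢ[ℝ] V, e x = y := ⟨_, Submodule.reflection_sub h⟩

variable [FiniteDimensional ℝ V] [MeasurableSpace V] [BorelSpace V]

theorem hausdorffMeasure_sphere_lt_top {d : ℕ} (hd : Module.finrank ℝ V = d + 1) :
    μH[d] (Metric.sphere (0 : V) 1) < ∞ := by
  refine (isCompact_sphere _ _).measure_lt_top_of_nhdsWithin fun x hx => ?_
  have hx1 : ‖x‖ = 1 := by simpa using hx
  have : Fact (Module.finrank ℝ V = d + 1) := ⟨hd⟩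
  have hF : Module.finrank ℝ (ℝ ∙ x)ᗮ = d :=
    Submodule.finrank_orthogonal_span_singleton (norm_ne_zero_iff.1 (by simp [hx1]))
  have hxx : ⟪x, x⟫ = 1 := by rw [real_inner_self_eq_norm_sq, hx1, one_pow]
  set ψ : (ℝ ∙ x)ᗮ → V := fun z => ‖x + (z : V)‖⁻¹ • (x + (z : V)) with hψ
  have hn : ∀ z : (ℝ ∙ x)ᗮ, 1 ≤ ‖x + (z : V)‖ := fun z => by
    have h0 : ⟪x, (z : V)⟫ = 0 := Submodule.mem_orthogonal_singleton_iff_inner_right.1 z.2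
    have := norm_add_sq_real x (z : V)
    rw [h0, hx1] at this
    nlinarith [norm_nonneg (x + (z : V)), sq_nonneg ‖(z : V)‖]
  have hL : LipschitzWith 1 ψ := LipschitzWith.of_dist_le_mul fun z w => by
    rw [dist_eq_norm, dist_eq_norm]
    have := norm_normalize_sub_normalize_le (hn z) (hn w)
    rw [add_sub_add_left_eq_sub] at this
    rwa [NNReal.coe_one, one_mul]
  set t : Set V := ψ '' Metric.closedBall 0 1
  have ht : μH[d] t < ∞ := by
    refine (hL.hausdorffMeasure_image_le (Nat.cast_nonneg d) _).trans_lt ?_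
    rw [← hF]
    simpa using (isCompact_closedBall (0 : (ℝ ∙ x)ᗮ) 1).measure_lt_top
  refine ⟨t, ?_, ht⟩
  have hcont : ContinuousAt (fun y : V => ⟪x, y⟫⁻¹ • y - x) x :=
    ((ContinuousAt.inv₀ (by fun_prop) (by rw [hxx]; exact one_ne_zero)).smul
      continuousAt_id).sub_const _
  have h1 : ∀ᶠ y in 𝓝 x, ⟪x, y⟫⁻¹ • y - x ∈ Metric.closedBall (0 : V) 1 := by
    refine hcont.eventually_mem (Metric.closedBall_mem_nhds_of_mem ?_)
    rw [hxx]
    simp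
  have h2 : ∀ᶠ y in 𝓝 x, 0 < ⟪x, y⟫ := by
    have : ContinuousAt (fun y : V => ⟪x, y⟫) x := by fun_prop
    exact this.eventually (lt_mem_nhds (hxx.symm ▸ one_pos : (0 : ℝ) < ⟪x, x⟫))
  filter_upwards [mem_nhdsWithin_of_mem_nhds h1, mem_nhdsWithin_of_mem_nhds h2,
    self_mem_nhdsWithin] with y hy1 hy2 hy3
  have hy : ‖y‖ = 1 := by simpa using hy3
  refine ⟨⟨⟪x, y⟫⁻¹ • y - x, ?_⟩, ?_, ?_⟩
  · rw [Submodule.mem_orthogonal_singleton_iff_inner_right, inner_sub_right, inner_smul_right,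
      hxx, inv_mul_cancel₀ hy2.ne', sub_self]
  · simpa using hy1
  · simp only [hψ, add_sub_cancel, norm_smul, hy, mul_one, norm_inv, Real.norm_eq_abs,
      abs_of_pos hy2, inv_inv]
    exact smul_inv_smul₀ hy2.ne' y

/-- On the unit sphere, Hausdorff measure is proportional to the Gaussian measure of cones. -/
theorem exists_hausdorffMeasure_sphere_inter_eq {d : ℕ} (hd : Module.finrank ℝ V = d + 1) :
    ∃ c : ℝ≥0∞, ∀ D : Set V, MeasurableSet D → (∀ x ∈ D, x ≠ 0) →
      (∀ x, ∀ t : ℝ, 0 < t → (t • x ∈ D ↔ x ∈ D)) →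
      μH[d] (Metric.sphere (0 : V) 1 ∩ D) = c * stdGaussian V D := by
  have : Nontrivial V := Module.nontrivial_of_finrank_pos (R := ℝ) (by omega)
  set S := Metric.sphere (0 : V) 1
  have hSm : MeasurableSet S := Metric.isClosed_sphere.measurableSet
  have hN : Measurable fun x : V => ‖x‖⁻¹ • x := by fun_prop
  have hNS : ∀ x : V, ‖x‖⁻¹ • x ∈ S ↔ x ≠ 0 := fun x => by
    by_cases hx : x = 0
    · simp [hx, S]
    · simp [hx, S, norm_smul]
  set μ : Measure V := μH[d].restrict S
  set ν : Measure V := ((stdGaussian V).map fun x => ‖x‖⁻¹ • x).restrict S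
  have : IsFiniteMeasure μ := ⟨by simpa [μ] using hausdorffMeasure_sphere_lt_top hd⟩
  have : IsFiniteMeasure ((stdGaussian V).map fun x => ‖x‖⁻¹ • x) := Measure.isFiniteMeasure_map _ _
  have hνapp : ∀ A, MeasurableSet A → ν A = stdGaussian V {x | x ≠ 0 ∧ ‖x‖⁻¹ • x ∈ A} :=
    fun A hA => by
      rw [Measure.restrict_apply hA, Measure.map_apply hN (hA.inter hSm)]
      congr 1
      ext x
      simp only [mem_preimage, mem_inter_iff, hNS, mem_ofPred_eq, and_comm]
  have hν : ν ≠ 0 := by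
    intro h
    have h1 := hνapp univ MeasurableSet.univ
    rw [h] at h1
    have h2 : IsOpen {x : V | x ≠ 0} := isOpen_ne
    obtain ⟨v, hv⟩ := exists_ne (0 : V)
    exact (h2.measure_pos (stdGaussian V) ⟨v, hv⟩).ne (by simpa using h1)
  obtain ⟨c, hc⟩ := exists_eq_smul_of_measure_ball_eq (μ := μ) (ν := ν) (S := S)
    (by simp [μ, hSm.compl]) (by simp [ν, hSm.compl]) hν
    (fun r x hx y hy => by
      obtain ⟨e, he⟩ := exists_linearIsometryEquiv_map_eq (x := x) (y := y)
        ((mem_sphere_zero_iff_norm.1 hx).trans (mem_sphere_zero_iff_norm.1 hy).symm)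
      rw [Measure.restrict_apply Metric.isOpen_ball.measurableSet,
        Measure.restrict_apply Metric.isOpen_ball.measurableSet,
        ← e.isometry.hausdorffMeasure_image (.inr e.surjective), image_inter e.injective]
      simp [S, he])
    (fun r x hx y hy => by
      obtain ⟨e, he⟩ := exists_linearIsometryEquiv_map_eq (x := x) (y := y)
        ((mem_sphere_zero_iff_norm.1 hx).trans (mem_sphere_zero_iff_norm.1 hy).symm)
      rw [hνapp _ Metric.isOpen_ball.measurableSet, hνapp _ Metric.isOpen_ball.measurableSet]
      conv_rhs => rw [← stdGaussian_map e]
      rw [Measure.map_apply e.continuous.measurable]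
      · congr 1
        ext z
        simp only [mem_ofPred_eq, mem_preimage, normalize_map, ← he, Metric.mem_ball, e.dist_map]
        simp
      · exact (measurableSet_singleton 0).compl.inter (hN Metric.isOpen_ball.measurableSet))
  refine ⟨c, fun D hD hD0 hDt => ?_⟩
  have h1 : μ D = c * ν D := by rw [hc]; rfl
  rw [hνapp D hD, Measure.restrict_apply hD, inter_comm] at h1
  rw [h1]
  congr 2
  ext x
  simp only [mem_ofPred_eq]
  refine ⟨fun h => (hDt _ _ (inv_pos.2 (norm_pos_iff.2 h.1))).1 h.2, fun h => ⟨hD0 x h, ?_⟩⟩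
  exact (hDt _ _ (inv_pos.2 (norm_pos_iff.2 (hD0 x h)))).2 h

end Sphere

section Gnomonic

variable {n : ℕ}

/-- Projection of `ℝ^{n+1}` onto its first `n` coordinates. -/
noncomputable def initProj (n : ℕ) :
    EuclideanSpace ℝ (Fin (n + 1)) →ₗ[ℝ] EuclideanSpace ℝ (Fin n) where
  toFun z := WithLp.toLp 2 fun i => z i.castSucc
  map_add' _ _ := rfl
  map_smul' _ _ := rfl

/-- The embedding `x ↦ (x, 1)` of `ℝⁿ` into `ℝ^{n+1}`. -/
noncomputable def liftOne (x : EuclideanSpace ℝ (Fin n)) : EuclideanSpace ℝ (Fin (n + 1)) :=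
  (EuclideanSpace.equiv (Fin (n + 1)) ℝ).symm (Fin.snoc (fun i => x i) 1)

/-- The cone over `A × {1}`. -/
def coneOver (A : Set (EuclideanSpace ℝ (Fin n))) : Set (EuclideanSpace ℝ (Fin (n + 1))) :=
  {z | 0 < z (Fin.last n) ∧ (z (Fin.last n))⁻¹ • initProj n z ∈ A}

theorem initProj_apply (z : EuclideanSpace ℝ (Fin (n + 1))) (i : Fin n) :
    initProj n z i = z i.castSucc := rfl

@[simp]
theorem liftOne_castSucc (x : EuclideanSpace ℝ (Fin n)) (i : Fin n) :
    liftOne x i.castSucc = x i := by simp [liftOne]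

@[simp]
theorem liftOne_last (x : EuclideanSpace ℝ (Fin n)) : liftOne x (Fin.last n) = 1 := by
  simp [liftOne]

@[simp]
theorem initProj_liftOne (x : EuclideanSpace ℝ (Fin n)) : initProj n (liftOne x) = x := by
  ext i
  simp [initProj_apply]

theorem norm_sq_eq_norm_initProj_sq_add (z : EuclideanSpace ℝ (Fin (n + 1))) :
    ‖z‖ ^ 2 = ‖initProj n z‖ ^ 2 + z (Fin.last n) ^ 2 := by
  simp [EuclideanSpace.norm_sq_eq, Fin.sum_univ_castSucc, initProj_apply]

theorem norm_liftOne_sq (x : EuclideanSpace ℝ (Fin n)) : ‖liftOne x‖ ^ 2 = 1 + ‖x‖ ^ 2 := by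
  rw [norm_sq_eq_norm_initProj_sq_add]
  simp [add_comm]

theorem one_le_norm_liftOne (x : EuclideanSpace ℝ (Fin n)) : 1 ≤ ‖liftOne x‖ := by
  nlinarith [norm_liftOne_sq x, sq_nonneg ‖x‖, norm_nonneg (liftOne x)]

theorem norm_liftOne_sub (x y : EuclideanSpace ℝ (Fin n)) : ‖liftOne x - liftOne y‖ = ‖x - y‖ := by
  rw [← sq_eq_sq₀ (norm_nonneg _) (norm_nonneg _), norm_sq_eq_norm_initProj_sq_add]
  simp

theorem gnomonic_eq (x : EuclideanSpace ℝ (Fin n)) :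
    gnomonic n x = ‖liftOne x‖⁻¹ • liftOne x := by
  rw [gnomonic, ← norm_liftOne_sq, Real.sqrt_sq (norm_nonneg _)]
  rfl

theorem lipschitzWith_gnomonic : LipschitzWith 1 (gnomonic n) :=
  LipschitzWith.of_dist_le_mul fun x y => by
    rw [dist_eq_norm, dist_eq_norm, gnomonic_eq, gnomonic_eq, NNReal.coe_one, one_mul,
      ← norm_liftOne_sub x y]
    exact norm_normalize_sub_normalize_le (one_le_norm_liftOne x) (one_le_norm_liftOne y)

theorem smul_mem_coneOver {A : Set (EuclideanSpace ℝ (Fin n))} (z : EuclideanSpace ℝ (Fin (n + 1)))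
    {t : ℝ} (ht : 0 < t) : t • z ∈ coneOver A ↔ z ∈ coneOver A := by
  have e : ((t • z) (Fin.last n))⁻¹ • initProj n (t • z) =
      (z (Fin.last n))⁻¹ • initProj n z := by
    rw [map_smul, smul_smul, PiLp.smul_apply, smul_eq_mul, mul_inv, mul_right_comm,
      inv_mul_cancel₀ ht.ne', one_mul]
  simp only [coneOver, mem_ofPred_eq, e]
  simp [ht]

theorem ne_zero_of_mem_coneOver {A : Set (EuclideanSpace ℝ (Fin n))}
    {z : EuclideanSpace ℝ (Fin (n + 1))} (hz : z ∈ coneOver A) : z ≠ 0 := by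
  rintro rfl
  simp [coneOver] at hz

theorem image_gnomonic (A : Set (EuclideanSpace ℝ (Fin n))) :
    gnomonic n '' A = Metric.sphere 0 1 ∩ coneOver A := by
  ext z
  constructor
  · rintro ⟨x, hx, rfl⟩
    have h0 : 0 < ‖liftOne x‖ := zero_lt_one.trans_le (one_le_norm_liftOne x)
    rw [gnomonic_eq]
    refine ⟨by simp [norm_smul, h0.ne'], (smul_mem_coneOver _ (inv_pos.2 h0)).2 ?_⟩
    simpa [coneOver] using hx
  · rintro ⟨hz1, hz0, hzA⟩
    refine ⟨_, hzA, ?_⟩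
    have e : liftOne ((z (Fin.last n))⁻¹ • initProj n z) = (z (Fin.last n))⁻¹ • z := by
      ext i
      refine Fin.lastCases ?_ (fun i => ?_) i
      · simp [hz0.ne']
      · simp [initProj_apply]
    rw [gnomonic_eq, e, norm_smul, mem_sphere_zero_iff_norm.1 hz1, mul_one, norm_inv,
      Real.norm_of_nonneg hz0.le, inv_inv, smul_inv_smul₀ hz0.ne']

theorem inner_pole (z : EuclideanSpace ℝ (Fin (n + 1))) : ⟪z, pole n⟫ = z (Fin.last n) := by
  simp [pole, EuclideanSpace.inner_single_right]

theorem hemisphere_eq : hemisphere n = Metric.sphere 0 1 ∩ coneOver univ := by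
  ext z
  simp [hemisphere, unitSphereSet, coneOver, inner_pole]

theorem isOpen_coneOver {A : Set (EuclideanSpace ℝ (Fin n))} (hA : IsOpen A) :
    IsOpen (coneOver A) := by
  have h0 : IsOpen {z : EuclideanSpace ℝ (Fin (n + 1)) | 0 < z (Fin.last n)} :=
    isOpen_lt continuous_const (by fun_prop)
  have hP : Continuous (initProj n) := LinearMap.continuous_of_finiteDimensional _
  refine ContinuousOn.isOpen_inter_preimage (f := fun z : EuclideanSpace ℝ (Fin (n + 1)) =>
    (z (Fin.last n))⁻¹ • initProj n z) ?_ h0 hA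
  have hl : ContinuousOn (fun z : EuclideanSpace ℝ (Fin (n + 1)) => z (Fin.last n))
      {z | 0 < z (Fin.last n)} := by fun_prop
  exact (hl.inv₀ fun z hz => ne_of_gt hz).smul hP.continuousOn

theorem convex_coneOver {A : Set (EuclideanSpace ℝ (Fin n))} (hA : Convex ℝ A) :
    Convex ℝ (coneOver A) := by
  rintro z ⟨hz, hzA⟩ w ⟨hw, hwA⟩ a b ha hb hab
  set p := z (Fin.last n)
  set q := w (Fin.last n)
  have hl : (a • z + b • w) (Fin.last n) = a * p + b * q := by simp [p, q]
  have hpos : 0 < a * p + b * q := by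
    rcases ha.eq_or_lt with rfl | ha'
    · simp_all
    · positivity
  refine ⟨hl ▸ hpos, ?_⟩
  rw [hl]
  have := hA hzA hwA (a := a * p / (a * p + b * q)) (b := b * q / (a * p + b * q))
    (by positivity) (by positivity) (by field_simp)
  convert this using 1
  rw [map_add, map_smul, map_smul, smul_add]
  simp only [smul_smul]
  congr 2 <;> field_simp

theorem liftOne_mem_coneOver {A : Set (EuclideanSpace ℝ (Fin n))} {x : EuclideanSpace ℝ (Fin n)}
    (hx : x ∈ A) : liftOne x ∈ coneOver A := by
  simpa [coneOver] using hx

theorem two_smul_pole_sub_mem_coneOver {A : Set (EuclideanSpace ℝ (Fin n))}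
    (hA : ∀ x ∈ A, -x ∈ A) {z : EuclideanSpace ℝ (Fin (n + 1))} (hz : z ∈ coneOver A) :
    (2 * z (Fin.last n)) • pole n - z ∈ coneOver A := by
  have hl : ((2 * z (Fin.last n)) • pole n - z) (Fin.last n) = z (Fin.last n) := by
    simp [pole]
    ring
  have hi : initProj n ((2 * z (Fin.last n)) • pole n - z) = -initProj n z := by
    ext i
    simp [initProj_apply, pole, (Fin.castSucc_lt_last i).ne]
  refine ⟨hz.1.trans_eq hl.symm, ?_⟩
  rw [hl, hi, smul_neg]
  exact hA _ hz.2

theorem hausdorffMeasure_image_gnomonic_interior {K : Set (EuclideanSpace ℝ (Fin n))}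
    (hK : Convex ℝ K) :
    μH[(n : ℝ)] (gnomonic n '' K) = μH[(n : ℝ)] (gnomonic n '' interior K) := by
  refine le_antisymm ?_ (measure_mono (image_mono interior_subset))
  have hfr : μH[(n : ℝ)] (frontier K) = 0 := by
    simpa using hK.addHaar_frontier
      (μH[(Module.finrank ℝ (EuclideanSpace ℝ (Fin n)) : ℝ)])
  have h0 : μH[(n : ℝ)] (gnomonic n '' frontier K) = 0 := by
    refine le_antisymm ((lipschitzWith_gnomonic.hausdorffMeasure_image_le
      (Nat.cast_nonneg n) _).trans ?_) (zero_le)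
    rw [hfr, mul_zero]
  calc μH[(n : ℝ)] (gnomonic n '' K)
      ≤ μH[(n : ℝ)] (gnomonic n '' interior K ∪ gnomonic n '' frontier K) := by
        rw [← image_union, ← closure_eq_interior_union_frontier]
        exact measure_mono (image_mono subset_closure)
    _ ≤ _ := (measure_union_le _ _).trans (by rw [h0, add_zero])

end Gnomonic

section Section

variable {V : Type*} [NormedAddCommGroup V] [InnerProductSpace ℝ V] [MeasurableSpace V]
  [BorelSpace V]

theorem hausdorffMeasure_sphere_inter_orthogonal {d : ℝ} (hd : 0 ≤ d) (u : V) (D : Set V) :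
    μH[d] (Metric.sphere 0 1 ∩ D ∩ {y | ⟪y, u⟫ = 0}) =
      μH[d] (Metric.sphere (0 : (ℝ ∙ u)ᗮ) 1 ∩ {z | (z : V) ∈ D}) := by
  rw [← (ℝ ∙ u)ᗮ.subtypeₗᵢ.isometry.hausdorffMeasure_image (.inl hd)]
  congr 1
  ext y
  simp only [mem_inter_iff, mem_image, mem_ofPred_eq, mem_sphere_zero_iff_norm]
  constructor
  · rintro ⟨⟨h1, h2⟩, h3⟩
    exact ⟨⟨y, Submodule.mem_orthogonal_singleton_iff_inner_left.2 h3⟩, ⟨h1, h2⟩, rfl⟩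
  · rintro ⟨z, ⟨h1, h2⟩, rfl⟩
    exact ⟨⟨h1, h2⟩, Submodule.mem_orthogonal_singleton_iff_inner_left.1 z.2⟩

end Section

/-- Waist-type inequality for central sections: the central
great-hypersphere section of the gnomonic image `K` of a bounded symmetric convex body,
relative to the volume of `K`, is at least as large as the corresponding ratio for the
hemisphere. -/
theorem central_section_waist (n : ℕ) (hn : 1 ≤ n)
    (K₀ : Set (EuclideanSpace ℝ (Fin n))) (hK₀conv : Convex ℝ K₀) (hK₀sym : K₀ = -K₀)
    (hK₀bdd : Bornology.IsBounded K₀) (hK₀int : (interior K₀).Nonempty)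
    (u : EuclideanSpace ℝ (Fin (n + 1))) (hu : ‖u‖ = 1) (huo : ⟪u, pole n⟫ = 0) :
    μH[(n : ℝ) - 1] ((gnomonic n '' K₀) ∩ {y | ⟪y, u⟫ = 0}) /
        μH[(n : ℝ)] (gnomonic n '' K₀) ≥
      μH[(n : ℝ) - 1] (unitSphereSet n ∩ {y | ⟪y, u⟫ = 0} ∩ hemisphere n) /
        μH[(n : ℝ)] (hemisphere n) := by
  obtain ⟨m, rfl⟩ : ∃ m, n = m + 1 := ⟨n - 1, by omega⟩
  have hV : Module.finrank ℝ (EuclideanSpace ℝ (Fin (m + 1 + 1))) = (m + 1) + 1 := by simp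
  have : Fact (Module.finrank ℝ (EuclideanSpace ℝ (Fin (m + 1 + 1))) = (m + 1) + 1) := ⟨hV⟩
  have hF : Module.finrank ℝ (ℝ ∙ u)ᗮ = m + 1 :=
    Submodule.finrank_orthogonal_span_singleton (norm_ne_zero_iff.1 (by simp [hu]))
  have hul : u (Fin.last (m + 1)) = 0 := by rw [← inner_pole, huo]
  obtain ⟨c₁, hc₁⟩ := exists_hausdorffMeasure_sphere_inter_eq hV
  obtain ⟨c₂, hc₂⟩ := exists_hausdorffMeasure_sphere_inter_eq hF
  have hvol : ∀ A : Set (EuclideanSpace ℝ (Fin (m + 1))), IsOpen A →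
      μH[((m + 1 : ℕ) : ℝ)] (Metric.sphere 0 1 ∩ coneOver A) =
        c₁ * stdGaussian _ (coneOver A) := fun A hA =>
    hc₁ _ (isOpen_coneOver hA).measurableSet (fun _ => ne_zero_of_mem_coneOver)
      fun z _ => smul_mem_coneOver z
  have hsec : ∀ A : Set (EuclideanSpace ℝ (Fin (m + 1))), IsOpen A →
      μH[(m : ℝ)] (Metric.sphere 0 1 ∩ coneOver A ∩ {y | ⟪y, u⟫ = 0}) =
        c₂ * stdGaussian (ℝ ∙ u)ᗮ {z | (z : EuclideanSpace ℝ (Fin (m + 1 + 1))) ∈ coneOver A} :=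
    fun A hA => by
      rw [hausdorffMeasure_sphere_inter_orthogonal (Nat.cast_nonneg m)]
      exact hc₂ _ (measurable_subtype_coe (isOpen_coneOver hA).measurableSet)
        (fun z hz h => ne_zero_of_mem_coneOver hz (by simp [h]))
        fun z _ => smul_mem_coneOver (z : EuclideanSpace ℝ (Fin (m + 1 + 1)))
  have hpos : ∀ A : Set (EuclideanSpace ℝ (Fin (m + 1))), IsOpen A → A.Nonempty →
      stdGaussian _ (coneOver A) ≠ 0 := fun A hA ⟨x, hx⟩ =>
    ((isOpen_coneOver hA).measure_pos _ ⟨_, liftOne_mem_coneOver hx⟩).ne'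
  have hsym : ∀ x ∈ interior K₀, -x ∈ interior K₀ := fun x hx => by
    have : -x ∈ Homeomorph.neg _ ⁻¹' interior K₀ := by simpa using hx
    rw [Homeomorph.preimage_interior] at this
    rw [hK₀sym]
    exact this
  set o : (ℝ ∙ u)ᗮ := ⟨pole (m + 1), Submodule.mem_orthogonal_singleton_iff_inner_right.2 huo⟩
  have ho : ‖o‖ = 1 := by simp [o, pole]
  have hslice := stdGaussian_le_stdGaussian_section hu (convex_coneOver hK₀conv.interior)
    (isOpen_coneOver isOpen_interior).measurableSet (ℝ ∙ o).reflection fun s z hz => by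
      have := two_smul_pole_sub_mem_coneOver hsym hz
      convert this using 1
      rw [Submodule.reflection_singleton_apply, ho]
      have e : ⟪o, z⟫ = (z : EuclideanSpace ℝ (Fin (m + 1 + 1))) (Fin.last (m + 1)) := by
        rw [← inner_pole, real_inner_comm]
        rfl
      rw [e]
      simp only [Submodule.coe_sub, PiLp.add_apply, PiLp.smul_apply, hul, o]
      simp
      module
  have hhalf := stdGaussian_eq_stdGaussian_section hu
    (C := coneOver (univ : Set (EuclideanSpace ℝ (Fin (m + 1)))))
    (isOpen_coneOver isOpen_univ).measurableSet (fun s z => by simp [coneOver, hul])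
  have hm : ((m + 1 : ℕ) : ℝ) - 1 = m := by simp
  rw [hausdorffMeasure_image_gnomonic_interior hK₀conv, hm, hemisphere_eq, image_gnomonic,
    image_gnomonic, hvol _ isOpen_interior, hvol _ isOpen_univ, ge_iff_le]
  have e : unitSphereSet (m + 1) ∩ {y | ⟪y, u⟫ = 0} ∩ (Metric.sphere 0 1 ∩ coneOver univ) =
      Metric.sphere 0 1 ∩ coneOver univ ∩ {y | ⟪y, u⟫ = 0} := by
    ext y
    simp only [unitSphereSet, mem_inter_iff]
    tauto
  rw [e, hsec _ isOpen_univ, ← hhalf,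
    ENNReal.mul_div_mul_right _ _ (hpos _ isOpen_univ univ_nonempty) (measure_ne_top _ _)]
  calc c₂ / c₁ = c₂ * stdGaussian _ (coneOver (interior K₀)) /
        (c₁ * stdGaussian _ (coneOver (interior K₀))) :=
      (ENNReal.mul_div_mul_right _ _ (hpos _ isOpen_interior hK₀int) (measure_ne_top _ _)).symm
    _ ≤ _ := by
      gcongr
      refine (mul_le_mul_right hslice c₂).trans ?_
      rw [← hsec _ isOpen_interior, ← image_gnomonic, ← image_gnomonic]
      gcongr
      exact interior_subset
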